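/- arXiv:1010.1512 — 2 statements merged into one kernel-verified Lean document; each statement's English description precedes it below -/
import Mathlib

section
/- For d ≥ 3, the integral G_1(z) := ∫_0^∞ (exp(tΔ)δ_0)(z) dt converges for every z ∈ ℤ^d, and for every z ∈ ℤ^d one has lim_{t→∞} M_z(t) = 1 + (γ/(κ+ρ − γ·G_1(0)))·G_1(z). -/
open Filter Topology BoundedContinuousFunction

section OrderedExp

variable {E : Type*} [NormedAddCommGroup E] [NormedSpace ℝ E] [CompleteSpace E] [PartialOrder E]
  [IsOrderedAddMonoid E] [OrderClosedTopology E] [PosSMulMono ℝ E]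

theorem exp_apply_nonneg_and_le {A B : E →L[ℝ] E} (hA : ∀ f, 0 ≤ f → 0 ≤ A f)
    (hAB : ∀ f, 0 ≤ f → A f ≤ B f) {f : E} (hf : 0 ≤ f) :
    0 ≤ NormedSpace.exp A f ∧ NormedSpace.exp A f ≤ NormedSpace.exp B f := by
  have hB : Monotone B := fun f g hfg => by
    have h := (hA _ (sub_nonneg.2 hfg)).trans (hAB _ (sub_nonneg.2 hfg))
    rwa [map_sub, sub_nonneg] at h
  have hpow : ∀ n : ℕ, 0 ≤ (A ^ n) f ∧ (A ^ n) f ≤ (B ^ n) f := by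
    intro n
    induction n with
    | zero => simpa using hf
    | succ n ih =>
      simp only [pow_succ']
      exact ⟨hA _ ih.1, (hAB _ ih.1).trans (hB ih.2)⟩
  have hsum : ∀ C : E →L[ℝ] E,
      HasSum (fun n : ℕ => ((n.factorial : ℝ)⁻¹) • (C ^ n) f) (NormedSpace.exp C f) := by
    intro C
    have h := NormedSpace.exp_series_hasSum_exp' (𝕂 := ℝ) C
    exact h.map (ContinuousLinearMap.apply ℝ E f) (ContinuousLinearMap.apply ℝ E f).continuous
  refine ⟨(hsum A).nonneg fun n => smul_nonneg (by positivity) (hpow n).1,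
    hasSum_le (fun n => ?_) (hsum A) (hsum B)⟩
  exact smul_le_smul_of_nonneg_left (hpow n).2 (by positivity)

theorem exp_smul_apply_nonneg_and_le {A B : E →L[ℝ] E} (K : ℝ)
    (hA : ∀ f, 0 ≤ f → 0 ≤ A f + K • f) (hAB : ∀ f, 0 ≤ f → A f ≤ B f) {f : E} (hf : 0 ≤ f)
    {t : ℝ} (ht : 0 ≤ t) :
    0 ≤ NormedSpace.exp (t • A) f ∧ NormedSpace.exp (t • A) f ≤ NormedSpace.exp (t • B) f := by
  have hshift : ∀ C : E →L[ℝ] E, NormedSpace.exp (t • C) f =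
      Real.exp (-(t * K)) • NormedSpace.exp (t • (C + K • (1 : E →L[ℝ] E))) f := by
    intro C
    let _ : NormedAlgebra ℚ (E →L[ℝ] E) := NormedAlgebra.restrictScalars ℚ ℝ _
    have h : t • C = algebraMap ℝ (E →L[ℝ] E) (-(t * K)) + t • (C + K • (1 : E →L[ℝ] E)) := by
      rw [Algebra.algebraMap_eq_smul_one]; module
    rw [h, NormedSpace.exp_add_of_commute (Algebra.commutes _ _),
      ← NormedSpace.algebraMap_exp_comm, Algebra.algebraMap_eq_smul_one, ← Real.exp_eq_exp_ℝ,
      smul_one_mul]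
    rfl
  have key := exp_apply_nonneg_and_le (A := t • (A + K • (1 : E →L[ℝ] E)))
    (B := t • (B + K • (1 : E →L[ℝ] E)))
    (fun g hg => smul_nonneg ht (hA g hg))
    (fun g hg => smul_le_smul_of_nonneg_left (add_le_add_left (hAB g hg) _) ht) hf
  rw [hshift A, hshift B]
  exact ⟨smul_nonneg (Real.exp_pos _).le key.1,
    smul_le_smul_of_nonneg_left key.2 (Real.exp_pos _).le⟩

end OrderedExp

theorem linear_ODE_unique {E : Type*} [NormedAddCommGroup E] [NormedSpace ℝ E] (A : E →L[ℝ] E)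
    {f g : ℝ → E} (hf : ∀ t, HasDerivAt f (A (f t)) t) (hg : ∀ t, HasDerivAt g (A (g t)) t)
    (h0 : f 0 = g 0) : f = g :=
  ODE_solution_unique_univ (v := fun _ => A) (s := fun _ => Set.univ) (K := ‖A‖₊)
    (fun _ => A.lipschitz.lipschitzOnWith) (fun t => ⟨hf t, trivial⟩)
    (fun t => ⟨hg t, trivial⟩) h0

theorem hasDerivAt_exp_smul_apply {E : Type*} [NormedAddCommGroup E] [NormedSpace ℝ E]
    [CompleteSpace E] (A : E →L[ℝ] E) (f : E) (t : ℝ) :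
    HasDerivAt (fun t : ℝ => NormedSpace.exp (t • A) f) (A (NormedSpace.exp (t • A) f)) t :=
  (ContinuousLinearMap.apply ℝ E f).hasFDerivAt.comp_hasDerivAt t
    (hasDerivAt_exp_smul_const' (𝕂 := ℝ) A t)

theorem exists_linear_ODE_solution {E : Type*} [NormedAddCommGroup E] [NormedSpace ℝ E]
    [CompleteSpace E] (A : E →L[ℝ] E) (f : E) :
    ∃ v : ℝ → E, v 0 = f ∧ ∀ t, HasDerivAt v (A (v t)) t :=
  ⟨fun t => NormedSpace.exp (t • A) f, by simp, hasDerivAt_exp_smul_apply A f⟩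

theorem linear_ODE_eq_exp {E : Type*} [NormedAddCommGroup E] [NormedSpace ℝ E]
    [CompleteSpace E] (A : E →L[ℝ] E) {v : ℝ → E} (hv : ∀ t, HasDerivAt v (A (v t)) t) (t : ℝ) :
    v t = NormedSpace.exp (t • A) (v 0) :=
  congrFun (linear_ODE_unique A hv (hasDerivAt_exp_smul_apply A (v 0)) (by simp)) t

/-- Comparison principle for linear differential equations in an ordered Banach space. -/
theorem linear_ODE_nonneg_and_le {E : Type*} [NormedAddCommGroup E] [NormedSpace ℝ E]
    [CompleteSpace E] [PartialOrder E] [IsOrderedAddMonoid E] [OrderClosedTopology E]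
    [PosSMulMono ℝ E] {A B : E →L[ℝ] E} (K : ℝ)
    (hA : ∀ f, 0 ≤ f → 0 ≤ A f + K • f) (hAB : ∀ f, 0 ≤ f → A f ≤ B f) {v w : ℝ → E}
    (hv : ∀ t, HasDerivAt v (A (v t)) t) (hw : ∀ t, HasDerivAt w (B (w t)) t)
    (h0 : 0 ≤ v 0) (hvw : v 0 = w 0) {t : ℝ} (ht : 0 ≤ t) : 0 ≤ v t ∧ v t ≤ w t := by
  rw [linear_ODE_eq_exp A hv, linear_ODE_eq_exp B hw, ← hvw]
  exact exp_smul_apply_nonneg_and_le K hA hAB h0 ht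

instance {α : Type*} [TopologicalSpace α] : OrderClosedTopology (α →ᵇ ℝ) where
  isClosed_le' := by
    have h : {p : (α →ᵇ ℝ) × (α →ᵇ ℝ) | p.1 ≤ p.2} = ⋂ x, {p | p.1 x ≤ p.2 x} := by
      ext p; simp only [Set.mem_ofPred_eq, Set.mem_iInter]; rfl
    rw [h]
    exact isClosed_iInter fun x => isClosed_le
      ((BoundedContinuousFunction.evalCLM ℝ x).continuous.comp continuous_fst)
      ((BoundedContinuousFunction.evalCLM ℝ x).continuous.comp continuous_snd)

instance {α : Type*} [TopologicalSpace α] : PosSMulMono ℝ (α →ᵇ ℝ) where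
  smul_le_smul_of_nonneg_left _ hc _ _ hfg x := mul_le_mul_of_nonneg_left (hfg x) hc

open MeasureTheory

theorem integral_fourier_haarAddCircle (n : ℤ) :
    ∫ x, fourier n x ∂(AddCircle.haarAddCircle (T := (1 : ℝ))) = if n = 0 then 1 else 0 := by
  split_ifs with h
  · simp [h]
  · exact integral_eq_zero_of_add_right_eq_neg (fourier_add_half_inv_index h Fact.out)

theorem integral_mFourier {d : ℕ} (n : Fin d → ℤ) :
    ∫ θ, UnitAddTorus.mFourier n θ
      ∂(Measure.pi fun _ : Fin d => AddCircle.haarAddCircle (T := (1 : ℝ))) =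
      if n = 0 then 1 else 0 := by
  have h := integral_fintype_prod_eq_prod
    (μ := fun _ : Fin d => AddCircle.haarAddCircle (T := (1 : ℝ))) (𝕜 := ℂ)
    (f := fun i x => fourier (n i) x)
  refine Eq.trans h ?_
  simp only [integral_fourier_haarAddCircle]
  split_ifs with hn
  · simp [hn]
  · obtain ⟨i, hi⟩ := Function.ne_iff.1 hn
    exact Finset.prod_eq_zero (Finset.mem_univ i) (by simpa using hi)

theorem norm_exp_fourier (t x : ℝ) :
    ‖Complex.exp ((t : ℂ) * (fourier 1 (x : UnitAddCircle) + fourier (-1) (x : UnitAddCircle) - 2))‖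
      = Real.exp (t * (2 * Real.cos (2 * Real.pi * x) - 2)) := by
  have h : fourier 1 (x : UnitAddCircle) + fourier (-1) (x : UnitAddCircle) =
      ((2 * Real.cos (2 * Real.pi * x) : ℝ) : ℂ) := by
    rw [fourier_coe_apply, fourier_coe_apply]
    push_cast
    rw [Complex.cos]
    ring_nf
  rw [h, Complex.norm_exp]
  norm_cast

theorem integral_norm_exp_fourier_le {t : ℝ} (ht : 0 < t) :
    ∫ x, ‖Complex.exp ((t : ℂ) * (fourier 1 x + fourier (-1) x - 2))‖
      ∂(AddCircle.haarAddCircle (T := (1 : ℝ))) ≤ √(Real.pi / (16 * t)) := by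
  have h1 : AddCircle.haarAddCircle (T := (1 : ℝ)) = volume := by
    rw [AddCircle.volume_eq_smul_haarAddCircle]; simp
  rw [h1, ← UnitAddCircle.intervalIntegral_preimage (-(1/2)),
    ← integral_gaussian (16 * t), intervalIntegral.integral_of_le (by norm_num)]
  simp only [norm_exp_fourier]
  have hint := integrable_exp_neg_mul_sq (b := 16 * t) (by positivity)
  refine (setIntegral_mono_on ?_ hint.integrableOn measurableSet_Ioc fun x hx => ?_).trans
    (setIntegral_le_integral hint (Eventually.of_forall fun x => (Real.exp_pos _).le))
  · exact (Continuous.integrableOn_Icc (by fun_prop)).mono_set Set.Ioc_subset_Icc_self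
  · have hx' : |x| ≤ 1 / 2 := abs_le.2 ⟨by linarith [hx.1], by linarith [hx.2]⟩
    have hpi := Real.pi_pos
    have h := Real.cos_le_one_sub_mul_cos_sq (x := 2 * Real.pi * x) (by
      rw [abs_mul, abs_of_pos (by positivity)]; nlinarith)
    have h2 : 2 / Real.pi ^ 2 * (2 * Real.pi * x) ^ 2 = 8 * x ^ 2 := by field_simp; ring
    rw [h2] at h
    exact Real.exp_le_exp.2 (by nlinarith)

/-- The normalized Haar measure on the torus. -/
noncomputable abbrev torusMeasure (d : ℕ) : Measure (UnitAddTorus (Fin d)) :=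
  Measure.pi fun _ => AddCircle.haarAddCircle (T := (1 : ℝ))

theorem integrable_torusMeasure {d : ℕ} (f : C(UnitAddTorus (Fin d), ℂ)) :
    Integrable f (torusMeasure d) :=
  f.continuous.integrable_of_hasCompactSupport (HasCompactSupport.of_compactSpace f)

theorem norm_integral_mFourier_mul_le {d : ℕ} (n : Fin d → ℤ) (f : C(UnitAddTorus (Fin d), ℂ)) :
    ‖∫ θ, (UnitAddTorus.mFourier n * f) θ ∂(torusMeasure d)‖ ≤ ∫ θ, ‖f θ‖ ∂(torusMeasure d) := by
  refine (norm_integral_le_integral_norm _).trans_eq (integral_congr_ae (.of_forall fun θ => ?_))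
  have h : ‖UnitAddTorus.mFourier n θ‖ = 1 := by
    simp only [UnitAddTorus.mFourier, fourier_apply, ContinuousMap.coe_mk, norm_prod,
      Circle.norm_coe, Finset.prod_const_one]
  simp only [ContinuousMap.mul_apply, norm_mul, h, one_mul]

theorem integral_norm_le_norm {d : ℕ} (f : C(UnitAddTorus (Fin d), ℂ)) :
    ∫ θ, ‖f θ‖ ∂(torusMeasure d) ≤ ‖f‖ := by
  refine (integral_mono (integrable_torusMeasure f).norm (integrable_const ‖f‖)
    fun θ => f.norm_coe_le_norm θ).trans_eq ?_
  simp

/-- The real parts of the Fourier coefficients of a continuous function on the torus. -/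
noncomputable def reFourierCoeff (d : ℕ) :
    C(UnitAddTorus (Fin d), ℂ) →L[ℝ] ((Fin d → ℤ) →ᵇ ℝ) :=
  LinearMap.mkContinuous
    { toFun := fun f => BoundedContinuousFunction.ofNormedAddCommGroupDiscrete
        (fun n => (∫ θ, (UnitAddTorus.mFourier (-n) * f) θ ∂(torusMeasure d)).re) ‖f‖ fun n =>
          (Complex.abs_re_le_norm _).trans
            ((norm_integral_mFourier_mul_le _ f).trans (integral_norm_le_norm f))
      map_add' := fun f g => by
        ext n
        have h := integral_add (integrable_torusMeasure (UnitAddTorus.mFourier (-n) * f))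
          (integrable_torusMeasure (UnitAddTorus.mFourier (-n) * g))
        simpa [mul_add] using congrArg Complex.re h
      map_smul' := fun c f => by
        ext n
        have h := integral_const_mul (μ := torusMeasure d) (c : ℂ)
          (UnitAddTorus.mFourier (-n) * f)
        simpa [mul_left_comm] using congrArg Complex.re h }
    1 fun f => by
      rw [one_mul]
      exact norm_ofNormedAddCommGroup_le continuous_of_discreteTopology (norm_nonneg f) fun n =>
        (Complex.abs_re_le_norm _).trans
          ((norm_integral_mFourier_mul_le _ f).trans (integral_norm_le_norm f))

theorem reFourierCoeff_apply {d : ℕ} (f : C(UnitAddTorus (Fin d), ℂ)) (n : Fin d → ℤ) :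
    reFourierCoeff d f n =
      (∫ θ, (UnitAddTorus.mFourier (-n) * f) θ ∂(torusMeasure d)).re := rfl

theorem norm_reFourierCoeff_le {d : ℕ} (f : C(UnitAddTorus (Fin d), ℂ)) :
    ‖reFourierCoeff d f‖ ≤ ∫ θ, ‖f θ‖ ∂(torusMeasure d) :=
  (BoundedContinuousFunction.norm_le (integral_nonneg fun _ => norm_nonneg _)).2 fun n =>
    (Complex.abs_re_le_norm _).trans (norm_integral_mFourier_mul_le (-n) f)

theorem reFourierCoeff_one {d : ℕ} (n : Fin d → ℤ) :
    reFourierCoeff d 1 n = if n = 0 then 1 else 0 := by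
  rw [reFourierCoeff_apply, mul_one, integral_mFourier]
  simp only [neg_eq_zero]
  split_ifs <;> simp

theorem reFourierCoeff_mFourier_mul {d : ℕ} (m n : Fin d → ℤ) (f : C(UnitAddTorus (Fin d), ℂ)) :
    reFourierCoeff d (UnitAddTorus.mFourier m * f) n = reFourierCoeff d f (n - m) := by
  have h : UnitAddTorus.mFourier (-(n - m)) =
      UnitAddTorus.mFourier (-n) * UnitAddTorus.mFourier m := by
    ext θ; rw [neg_sub, sub_eq_neg_add, UnitAddTorus.mFourier_add]; rfl
  rw [reFourierCoeff_apply, reFourierCoeff_apply, h, mul_assoc]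

/-- The Fourier symbol of the discrete Laplacian. -/
noncomputable def laplacianSymbol (d : ℕ) : C(UnitAddTorus (Fin d), ℂ) :=
  ∑ i, (UnitAddTorus.mFourier (Pi.single i 1) + UnitAddTorus.mFourier (-Pi.single i 1) - (2 : ℝ) • 1)

theorem reFourierCoeff_laplacianSymbol_mul {d : ℕ} (f : C(UnitAddTorus (Fin d), ℂ))
    (x : Fin d → ℤ) :
    reFourierCoeff d (laplacianSymbol d * f) x = ∑ i : Fin d,
      ((reFourierCoeff d f (x + Pi.single i 1) - reFourierCoeff d f x) +
        (reFourierCoeff d f (x - Pi.single i 1) - reFourierCoeff d f x)) := by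
  simp only [laplacianSymbol, Finset.sum_mul, map_sum, BoundedContinuousFunction.coe_sum,
    Finset.sum_apply, sub_mul, add_mul, map_sub, map_add, BoundedContinuousFunction.coe_add,
    BoundedContinuousFunction.coe_sub, Pi.add_apply, Pi.sub_apply, reFourierCoeff_mFourier_mul,
    sub_neg_eq_add, smul_one_mul, map_smul, BoundedContinuousFunction.coe_smul, smul_eq_mul]
  exact Finset.sum_congr rfl fun i _ => by ring

theorem exp_laplacianSymbol_apply {d : ℕ} (t : ℝ) (θ : UnitAddTorus (Fin d)) :
    NormedSpace.exp (t • laplacianSymbol d) θ =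
      ∏ i, Complex.exp ((t : ℂ) * (fourier 1 (θ i) + fourier (-1) (θ i) - 2)) := by
  have h := NormedSpace.map_exp (ContinuousMap.evalAlgHom ℂ ℂ θ)
    (continuous_eval_const θ) (t • laplacianSymbol d)
  refine h.trans ?_
  rw [← Complex.exp_sum, Complex.exp_eq_exp_ℂ, ← Finset.mul_sum]
  congr 1
  have h' : ∀ i, UnitAddTorus.mFourier (-Pi.single i 1) θ = fourier (-1) (θ i) := fun i => by
    rw [UnitAddTorus.mFourier_neg, UnitAddTorus.mFourier_single, fourier_neg]
  simp [laplacianSymbol, UnitAddTorus.mFourier_single, h', mul_comm]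

theorem norm_reFourierCoeff_exp_le {d : ℕ} (hd : 3 ≤ d) {t : ℝ} (ht : 1 ≤ t) :
    ‖reFourierCoeff d (NormedSpace.exp (t • laplacianSymbol d))‖ ≤ t ^ (-(3 / 2) : ℝ) := by
  have ht0 : 0 < t := by linarith
  refine (norm_reFourierCoeff_le _).trans ?_
  simp only [exp_laplacianSymbol_apply, norm_prod]
  rw [integral_fintype_prod_eq_pow
    (fun x => ‖Complex.exp ((t : ℂ) * (fourier 1 x + fourier (-1) x - 2))‖), Fintype.card_fin]
  have h1 : √(Real.pi / (16 * t)) ≤ √(t⁻¹) := Real.sqrt_le_sqrt (by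
    rw [div_le_iff₀ (by positivity)]; field_simp; linarith [Real.pi_le_four])
  have h2 : √(t⁻¹) ≤ 1 := Real.sqrt_le_one.2 (inv_le_one_of_one_le₀ ht)
  refine (pow_le_pow_left₀ (integral_nonneg fun _ => norm_nonneg _)
    ((integral_norm_exp_fourier_le ht0).trans h1) d).trans
    ((pow_le_pow_of_le_one (Real.sqrt_nonneg _) h2 hd).trans_eq ?_)
  rw [Real.sqrt_eq_rpow, ← Real.rpow_natCast, ← Real.rpow_mul (by positivity), Real.inv_rpow ht0.le,
    ← Real.rpow_neg ht0.le]
  norm_num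

section LatticeLaplacian

variable {d : ℕ} {L : ((Fin d → ℤ) →ᵇ ℝ) →L[ℝ] ((Fin d → ℤ) →ᵇ ℝ)} {δ₀ : (Fin d → ℤ) →ᵇ ℝ}
  {w : ℝ → ((Fin d → ℤ) →ᵇ ℝ)}

theorem heat_eq_reFourierCoeff
    (hL : ∀ (f : (Fin d → ℤ) →ᵇ ℝ) (x : Fin d → ℤ),
      L f x = ∑ i : Fin d,
        ((f (x + Pi.single i 1) - f x) + (f (x - Pi.single i 1) - f x)))
    (hδ₀ : ∀ x : Fin d → ℤ, δ₀ x = if x = 0 then 1 else 0)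
    (hw0 : w 0 = δ₀) (hw : ∀ t : ℝ, HasDerivAt w (L (w t)) t) :
    w = fun t => reFourierCoeff d (NormedSpace.exp (t • laplacianSymbol d)) := by
  refine linear_ODE_unique L hw (fun t => ?_) ?_
  · have h := (reFourierCoeff d).hasFDerivAt.comp_hasDerivAt t
      (hasDerivAt_exp_smul_const' (𝕂 := ℝ) (laplacianSymbol d) t)
    refine h.congr_deriv ?_
    ext x
    rw [hL, reFourierCoeff_laplacianSymbol_mul]
  · have h : NormedSpace.exp ((0 : ℝ) • laplacianSymbol d) = 1 := by
      ext1 θ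
      rw [exp_laplacianSymbol_apply]
      simp
    ext x
    rw [h, hw0, hδ₀, reFourierCoeff_one]

theorem norm_heat_le (hd : 3 ≤ d)
    (hL : ∀ (f : (Fin d → ℤ) →ᵇ ℝ) (x : Fin d → ℤ),
      L f x = ∑ i : Fin d,
        ((f (x + Pi.single i 1) - f x) + (f (x - Pi.single i 1) - f x)))
    (hδ₀ : ∀ x : Fin d → ℤ, δ₀ x = if x = 0 then 1 else 0)
    (hw0 : w 0 = δ₀) (hw : ∀ t : ℝ, HasDerivAt w (L (w t)) t) {t : ℝ} (ht : 1 ≤ t) :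
    ‖w t‖ ≤ t ^ (-(3 / 2) : ℝ) := by
  rw [heat_eq_reFourierCoeff hL hδ₀ hw0 hw]
  exact norm_reFourierCoeff_exp_le hd ht

theorem heat_tendsto_zero (hd : 3 ≤ d)
    (hL : ∀ (f : (Fin d → ℤ) →ᵇ ℝ) (x : Fin d → ℤ),
      L f x = ∑ i : Fin d,
        ((f (x + Pi.single i 1) - f x) + (f (x - Pi.single i 1) - f x)))
    (hδ₀ : ∀ x : Fin d → ℤ, δ₀ x = if x = 0 then 1 else 0)
    (hw0 : w 0 = δ₀) (hw : ∀ t : ℝ, HasDerivAt w (L (w t)) t) :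
    Tendsto w atTop (𝓝 0) :=
  squeeze_zero_norm' ((eventually_ge_atTop 1).mono fun _ => norm_heat_le hd hL hδ₀ hw0 hw)
    (tendsto_rpow_neg_atTop (by norm_num))

theorem integrableOn_heat (hd : 3 ≤ d)
    (hL : ∀ (f : (Fin d → ℤ) →ᵇ ℝ) (x : Fin d → ℤ),
      L f x = ∑ i : Fin d,
        ((f (x + Pi.single i 1) - f x) + (f (x - Pi.single i 1) - f x)))
    (hδ₀ : ∀ x : Fin d → ℤ, δ₀ x = if x = 0 then 1 else 0)
    (hw0 : w 0 = δ₀) (hw : ∀ t : ℝ, HasDerivAt w (L (w t)) t) :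
    IntegrableOn w (Set.Ioi 0) := by
  have hcont : Continuous w := continuous_iff_continuousAt.2 fun t => (hw t).continuousAt
  rw [← Set.Ioc_union_Ioi_eq_Ioi (zero_le_one' ℝ)]
  refine (hcont.integrableOn_Icc.mono_set Set.Ioc_subset_Icc_self).union ?_
  refine Integrable.mono' (integrableOn_Ioi_rpow_of_lt (a := -(3 / 2)) (by norm_num) one_pos)
    hcont.aestronglyMeasurable ?_
  refine (ae_restrict_iff' measurableSet_Ioi).2 (.of_forall fun t ht => ?_)
  exact norm_heat_le hd hL hδ₀ hw0 hw (le_of_lt ht)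

theorem laplacian_integral_heat (hd : 3 ≤ d)
    (hL : ∀ (f : (Fin d → ℤ) →ᵇ ℝ) (x : Fin d → ℤ),
      L f x = ∑ i : Fin d,
        ((f (x + Pi.single i 1) - f x) + (f (x - Pi.single i 1) - f x)))
    (hδ₀ : ∀ x : Fin d → ℤ, δ₀ x = if x = 0 then 1 else 0)
    (hw0 : w 0 = δ₀) (hw : ∀ t : ℝ, HasDerivAt w (L (w t)) t) :
    L (∫ t in Set.Ioi (0 : ℝ), w t) = -δ₀ := by
  have hint := integrableOn_heat hd hL hδ₀ hw0 hw
  rw [← L.integral_comp_comm hint, integral_Ioi_of_hasDerivAt_of_tendsto' (fun t _ => hw t)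
    (L.integrable_comp hint) (heat_tendsto_zero hd hL hδ₀ hw0 hw), hw0, zero_sub]

theorem laplacian_add_smul_nonneg
    (hL : ∀ (f : (Fin d → ℤ) →ᵇ ℝ) (x : Fin d → ℤ),
      L f x = ∑ i : Fin d,
        ((f (x + Pi.single i 1) - f x) + (f (x - Pi.single i 1) - f x)))
    {f : (Fin d → ℤ) →ᵇ ℝ} (hf : 0 ≤ f) : 0 ≤ L f + (2 * d : ℝ) • f := by
  intro x
  have h : L f x + 2 * d * f x = ∑ i : Fin d, (f (x + Pi.single i 1) + f (x - Pi.single i 1)) := by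
    have h' : (2 * d * f x : ℝ) = ∑ _i : Fin d, 2 * f x := by
      rw [Finset.sum_const, Finset.card_univ, Fintype.card_fin, nsmul_eq_mul]; ring
    rw [hL, h', ← Finset.sum_add_distrib]
    exact Finset.sum_congr rfl fun i _ => by ring
  change 0 ≤ L f x + 2 * d * f x
  rw [h]
  exact Finset.sum_nonneg fun i _ => add_nonneg (hf _) (hf _)

theorem integral_heat_nonneg
    (hL : ∀ (f : (Fin d → ℤ) →ᵇ ℝ) (x : Fin d → ℤ),
      L f x = ∑ i : Fin d,
        ((f (x + Pi.single i 1) - f x) + (f (x - Pi.single i 1) - f x)))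
    (hδ₀ : ∀ x : Fin d → ℤ, δ₀ x = if x = 0 then 1 else 0)
    (hw0 : w 0 = δ₀) (hw : ∀ t : ℝ, HasDerivAt w (L (w t)) t) (z : Fin d → ℤ) :
    0 ≤ ∫ t in Set.Ioi (0 : ℝ), w t z := by
  have hδ : 0 ≤ w 0 := fun x => by
    rw [hw0]
    exact (by split_ifs <;> norm_num : (0 : ℝ) ≤ if x = 0 then 1 else 0).trans_eq (hδ₀ x).symm
  exact setIntegral_nonneg measurableSet_Ioi fun t ht => (linear_ODE_nonneg_and_le (2 * d : ℝ)
    (fun f hf => laplacian_add_smul_nonneg hL hf) (fun f _ => le_rfl) hw hw hδ rfl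
    (le_of_lt ht)).1 z

end LatticeLaplacian

/-- For `d ≥ 3`, the Green's function
`G_1(z) = ∫_0^∞ (exp(tΔ)δ_0)(z) dt` of the simple random walk with generator `Δ`
is finite for every `z ∈ ℤ^d`, and the expected total mass
`M_z(t) = (exp(tH) 𝟙)(z)` of the parabolic Anderson model with a moving trap,
where `H = (κ+ρ)Δ + γV` on `ℓ^∞(ℤ^d)`, satisfies
`lim_{t→∞} M_z(t) = 1 + (γ/(κ+ρ − γ G_1(0)))·G_1(z)`.
Semigroups `exp(tΔ)δ_0` and `exp(tH) 𝟙` are encoded as the (unique, since the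
operators are bounded) solutions of the corresponding linear ODEs. -/
theorem moving_trap_localized_total_mass_dim_ge_three
    (d : ℕ) (hd : 3 ≤ d)
    (κ ρ γ : ℝ) (hκ : 0 < κ) (hρ : 0 < ρ) (hγ : γ < 0)
    (L : ((Fin d → ℤ) →ᵇ ℝ) →L[ℝ] ((Fin d → ℤ) →ᵇ ℝ))
    (hL : ∀ (f : (Fin d → ℤ) →ᵇ ℝ) (x : Fin d → ℤ),
      L f x = ∑ i : Fin d,
        ((f (x + Pi.single i 1) - f x) + (f (x - Pi.single i 1) - f x)))
    (H : ((Fin d → ℤ) →ᵇ ℝ) →L[ℝ] ((Fin d → ℤ) →ᵇ ℝ))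
    (hH : ∀ (f : (Fin d → ℤ) →ᵇ ℝ) (x : Fin d → ℤ),
      H f x = (κ + ρ) * L f x + γ * (if x = 0 then f x else 0))
    (δ₀ : (Fin d → ℤ) →ᵇ ℝ)
    (hδ₀ : ∀ x : Fin d → ℤ, δ₀ x = if x = 0 then 1 else 0)
    (u : ℝ → ((Fin d → ℤ) →ᵇ ℝ)) (hu0 : u 0 = 1)
    (hu : ∀ t : ℝ, HasDerivAt u (H (u t)) t)
    (w : ℝ → ((Fin d → ℤ) →ᵇ ℝ)) (hw0 : w 0 = δ₀)
    (hw : ∀ t : ℝ, HasDerivAt w (L (w t)) t)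
    (M : (Fin d → ℤ) → ℝ → ℝ)
    (hM : ∀ (z : Fin d → ℤ) (t : ℝ), M z t = u t z)
    (G : (Fin d → ℤ) → ℝ)
    (hG : ∀ z : Fin d → ℤ, G z = ∫ t in Set.Ioi (0 : ℝ), w t z) :
    (∀ z : Fin d → ℤ, MeasureTheory.IntegrableOn (fun t : ℝ => w t z) (Set.Ioi 0)) ∧
    ∀ z : Fin d → ℤ,
      Tendsto (fun t : ℝ => M z t) atTop (𝓝 (1 + γ / (κ + ρ - γ * G 0) * G z)) := by
  have hint := integrableOn_heat hd hL hδ₀ hw0 hw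
  have hcont : Continuous w := continuous_iff_continuousAt.2 fun t => (hw t).continuousAt
  refine ⟨fun z => ContinuousLinearMap.integrable_comp (φ := w)
    (BoundedContinuousFunction.evalCLM ℝ z) hint, fun z => ?_⟩
  set 𝓖 : (Fin d → ℤ) →ᵇ ℝ := ∫ t in Set.Ioi (0 : ℝ), w t with h𝓖
  have h𝓖G : ∀ x, 𝓖 x = G x := fun x =>
    ((BoundedContinuousFunction.evalCLM ℝ x).integral_comp_comm hint).symm.trans (hG x).symm
  have hG0 : ∀ x, 0 ≤ G x := fun x => hG x ▸ integral_heat_nonneg hL hδ₀ hw0 hw x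
  have hL𝓖 : L 𝓖 = -δ₀ := laplacian_integral_heat hd hL hδ₀ hw0 hw
  have hc : 0 < κ + ρ := add_pos hκ hρ
  have hden : 0 < κ + ρ - γ * G 0 := by nlinarith [hG0 0]
  set a : ℝ := γ / (κ + ρ - γ * G 0) with ha
  obtain ⟨v, hv0, hv⟩ := exists_linear_ODE_solution H 𝓖
  have hstat : H (1 + a • 𝓖) = 0 := by
    ext x
    have hL1 : L 1 = 0 := by ext y; simp [hL]
    rw [hH, map_add, map_smul, hL𝓖, hL1]
    by_cases hx : x = 0
    · subst hx
      simp only [BoundedContinuousFunction.coe_add, BoundedContinuousFunction.coe_smul,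
        BoundedContinuousFunction.coe_neg, BoundedContinuousFunction.coe_zero,
        BoundedContinuousFunction.coe_one, Pi.add_apply, Pi.neg_apply, Pi.zero_apply,
        Pi.one_apply, smul_eq_mul, hδ₀, h𝓖G, if_true, ha]
      field_simp
      ring
    · simp [hδ₀, hx]
  have hu_eq : u = fun t => (1 + a • 𝓖) - a • v t := by
    refine linear_ODE_unique H hu (fun t => ?_) (by simp [hu0, hv0])
    rw [map_sub, hstat, map_smul, zero_sub]
    exact ((hv t).const_smul a).const_sub _
  let q : ℝ → ((Fin d → ℤ) →ᵇ ℝ) := fun t => 𝓖 - ∫ s in (0 : ℝ)..((κ + ρ) * t), w s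
  have hq : ∀ t, HasDerivAt q (((κ + ρ) • L) (q t)) t := by
    intro t
    have h1 : HasDerivAt (fun s : ℝ => (κ + ρ) * s) (κ + ρ) t := by
      simpa using (hasDerivAt_id t).const_mul (κ + ρ)
    have h2 := (intervalIntegral.integral_hasDerivAt_right
      (hcont.intervalIntegrable 0 ((κ + ρ) * t))
      hcont.aestronglyMeasurable.stronglyMeasurableAtFilter hcont.continuousAt).scomp t h1
    refine (h2.const_sub 𝓖).congr_deriv ?_
    have h3 : L (∫ s in (0 : ℝ)..((κ + ρ) * t), w s) = w ((κ + ρ) * t) - δ₀ := by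
      rw [← L.intervalIntegral_comp_comm (hcont.intervalIntegrable _ _), ← hw0]
      exact intervalIntegral.integral_eq_sub_of_hasDerivAt (fun s _ => hw s)
        ((L.continuous.comp hcont).intervalIntegrable _ _)
    change _ = (κ + ρ) • L (𝓖 - ∫ s in (0 : ℝ)..((κ + ρ) * t), w s)
    rw [map_sub, hL𝓖, h3, neg_sub_left, sub_add_cancel, smul_neg]
  have hq_lim : Tendsto q atTop (𝓝 0) := by
    have h := (MeasureTheory.intervalIntegral_tendsto_integral_Ioi 0 hint
      (tendsto_id.const_mul_atTop hc)).const_sub 𝓖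
    rwa [← h𝓖, sub_self] at h
  have hcomp : ∀ t, 0 ≤ t → 0 ≤ v t ∧ v t ≤ q t := fun t ht => by
    refine linear_ODE_nonneg_and_le ((κ + ρ) * (2 * d) - γ) (fun f hf x => ?_) (fun f hf x => ?_)
      hv hq ?_ (by simp [q, hv0]) ht
    · have h1 : 0 ≤ L f x + 2 * d * f x := laplacian_add_smul_nonneg hL hf x
      have h2 : 0 ≤ f x := hf x
      change 0 ≤ H f x + ((κ + ρ) * (2 * d) - γ) * f x
      rw [hH]
      split_ifs <;> nlinarith [mul_nonneg hc.le h1]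
    · have h2 : 0 ≤ f x := hf x
      change H f x ≤ (κ + ρ) * L f x
      rw [hH]
      split_ifs <;> nlinarith
    · rw [hv0]
      exact fun x => (hG0 x).trans_eq (h𝓖G x).symm
  have hv_lim : Tendsto (fun t => v t z) atTop (𝓝 0) := by
    have h := ((BoundedContinuousFunction.evalCLM ℝ z).continuous.tendsto 0).comp hq_lim
    rw [map_zero] at h
    exact tendsto_of_tendsto_of_tendsto_of_le_of_le' tendsto_const_nhds h
      ((eventually_ge_atTop 0).mono fun t ht => (hcomp t ht).1 z)
      ((eventually_ge_atTop 0).mono fun t ht => (hcomp t ht).2 z)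
  have hlim := (hv_lim.const_mul a).const_sub (1 + a * G z)
  rw [mul_zero, sub_zero] at hlim
  refine hlim.congr fun t => ?_
  rw [hM, hu_eq]
  simp [h𝓖G]
end

section
/- For d = 1, the large-time behaviour of the expected mass with homogeneous initial condition does not depend on the strength γ < 0 of the trap: for any two coupling constants γ₁, γ₂ ∈ (−∞, 0) and every x ∈ ℤ, lim_{t→∞} ( m_x^{γ₁}(t) − m_x^{γ₂}(t) ) = 0. -/
open Filter Topology BoundedContinuousFunction

/-- One step of a lazy nearest-neighbour walk on `ℤ`, killed at the origin with probability `θ`. -/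
noncomputable def killedStep (q θ : ℝ) : (ℤ → ℝ) →ₗ[ℝ] (ℤ → ℝ) where
  toFun u d := q * (u (d + 1) + u (d - 1)) + (1 - 2 * q - if d = 0 then θ else 0) * u d
  map_add' u v := by ext d; simp only [Pi.add_apply]; ring
  map_smul' c u := by ext d; simp only [Pi.smul_apply, smul_eq_mul, RingHom.id_apply]; ring

/-- One step of a lazy pair of walks on `ℤ`, killed on the diagonal with probability `θ`. -/
noncomputable def pairStep (k r θ : ℝ) : (ℤ × ℤ → ℝ) →ₗ[ℝ] (ℤ × ℤ → ℝ) where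
  toFun f p := k * (f (p.1 + 1, p.2) + f (p.1 - 1, p.2)) + r * (f (p.1, p.2 + 1) + f (p.1, p.2 - 1))
    + (1 - 2 * k - 2 * r - if p.1 = p.2 then θ else 0) * f p
  map_add' u v := by ext p; simp only [Pi.add_apply]; ring
  map_smul' c u := by ext p; simp only [Pi.smul_apply, smul_eq_mul, RingHom.id_apply]; ring

lemma killedStep_apply (q θ : ℝ) (u : ℤ → ℝ) (d : ℤ) : killedStep q θ u d =
    q * (u (d + 1) + u (d - 1)) + (1 - 2 * q - if d = 0 then θ else 0) * u d := rfl

lemma pairStep_apply (k r θ : ℝ) (f : ℤ × ℤ → ℝ) (x y : ℤ) : pairStep k r θ f (x, y) =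
    k * (f (x + 1, y) + f (x - 1, y)) + r * (f (x, y + 1) + f (x, y - 1))
    + (1 - 2 * k - 2 * r - if x = y then θ else 0) * f (x, y) := rfl

lemma linearMap_pow_succ_apply {E : Type*} [AddCommGroup E] [Module ℝ E] (T : E →ₗ[ℝ] E)
    (n : ℕ) (u : E) :
    (T ^ (n + 1)) u = T ((T ^ n) u) := by
  rw [pow_succ', Module.End.mul_apply]

lemma linearMap_pow_monotone {E : Type*} [AddCommGroup E] [Module ℝ E] [Preorder E] {T : E →ₗ[ℝ] E}
    (hT : Monotone T) (n : ℕ) : Monotone (T ^ n : E →ₗ[ℝ] E) := by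
  rw [Module.End.coe_pow]; exact hT.iterate n

lemma killedStep_monotone {q θ : ℝ} (hq : 0 ≤ q) (hθ : 0 ≤ θ) (h : 2 * q + θ ≤ 1) :
    Monotone (killedStep q θ) := by
  intro u v huv d
  simp only [killedStep_apply]
  have : 0 ≤ 1 - 2 * q - if d = 0 then θ else 0 := by split_ifs <;> linarith
  gcongr <;> exact huv _

lemma pairStep_monotone {k r θ : ℝ} (hk : 0 ≤ k) (hr : 0 ≤ r) (hθ : 0 ≤ θ)
    (h : 2 * k + 2 * r + θ ≤ 1) : Monotone (pairStep k r θ) := by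
  rintro u v huv ⟨x, y⟩
  simp only [pairStep_apply]
  have : 0 ≤ 1 - 2 * k - 2 * r - if x = y then θ else 0 := by split_ifs <;> linarith
  gcongr <;> exact huv _

lemma killedStep_one (q θ : ℝ) (d : ℤ) :
    killedStep q θ 1 d = 1 - if d = 0 then θ else 0 := by
  simp only [killedStep_apply, Pi.one_apply]; ring

lemma survival_antitone {q θ : ℝ} (hq : 0 ≤ q) (hθ : 0 ≤ θ) (h : 2 * q + θ ≤ 1) :
    Antitone fun n : ℕ => (killedStep q θ ^ n) 1 := by
  refine antitone_nat_of_succ_le fun n => ?_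
  rw [pow_succ, Module.End.mul_apply]
  refine linearMap_pow_monotone (killedStep_monotone hq hθ h) n fun d => ?_
  rw [killedStep_one, Pi.one_apply]
  split_ifs <;> linarith

lemma survival_nonneg {q θ : ℝ} (hq : 0 ≤ q) (hθ : 0 ≤ θ) (h : 2 * q + θ ≤ 1) (n : ℕ) :
    0 ≤ (killedStep q θ ^ n) 1 := by
  simpa using linearMap_pow_monotone (killedStep_monotone hq hθ h) n (zero_le_one : (0 : ℤ → ℝ) ≤ 1)

lemma pow_natAbs_neighbours {x : ℝ} (hx : 0 < x) {d : ℤ} (hd : d ≠ 0) :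
    x ^ (d + 1).natAbs + x ^ (d - 1).natAbs = (x + x⁻¹) * x ^ d.natAbs := by
  obtain ⟨m, rfl | rfl⟩ : ∃ m : ℕ, d = (m + 1 : ℕ) ∨ d = -((m + 1 : ℕ) : ℤ) := by
    refine ⟨d.natAbs - 1, ?_⟩; omega
  · rw [show ((m + 1 : ℕ) + 1 : ℤ).natAbs = m + 2 by omega,
      show ((m + 1 : ℕ) - 1 : ℤ).natAbs = m by omega,
      show ((m + 1 : ℕ) : ℤ).natAbs = m + 1 by omega]
    field_simp; ring
  · rw [show (-((m + 1 : ℕ) : ℤ) + 1 : ℤ).natAbs = m by omega,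
      show (-((m + 1 : ℕ) : ℤ) - 1 : ℤ).natAbs = m + 2 by omega,
      show (-((m + 1 : ℕ) : ℤ)).natAbs = m + 1 by omega]
    field_simp; ring

lemma one_sub_survival_le {q θ x : ℝ} (hq : 0 ≤ q) (hθ : 0 ≤ θ) (h : 2 * q + θ ≤ 1)
    (hx : 0 < x) (n : ℕ) (d : ℤ) :
    1 - (killedStep q θ ^ n) 1 d ≤ (1 + q * (x + x⁻¹ - 2)) ^ n * x ^ d.natAbs := by
  have hB : 0 ≤ x + x⁻¹ - 2 := by
    have : x + x⁻¹ - 2 = (x - 1) ^ 2 / x := by field_simp; ring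
    rw [this]; positivity
  induction n generalizing d with
  | zero => simp; positivity
  | succ n ih =>
    rcases eq_or_ne d 0 with rfl | hd
    · have h1 := survival_nonneg hq hθ h (n + 1) 0
      have h2 : 1 ≤ (1 + q * (x + x⁻¹ - 2)) ^ (n + 1) := one_le_pow₀ (by nlinarith)
      simp only [Pi.zero_apply] at h1
      simp only [Int.natAbs_zero, pow_zero, mul_one]
      linarith
    · rw [linearMap_pow_succ_apply, killedStep_apply, if_neg hd]
      have e := pow_natAbs_neighbours hx hd
      have h1 := mul_le_mul_of_nonneg_left (add_le_add (ih (d + 1)) (ih (d - 1))) hq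
      have h2 := mul_le_mul_of_nonneg_left (ih d) (show 0 ≤ 1 - 2 * q by linarith)
      rw [← mul_add, e] at h1
      rw [pow_succ]
      linear_combination h1 + h2

lemma hasSum_of_eq {ι : Type*} {f g : ι → ℝ} {a b : ℝ} (h : HasSum f a) (hf : ∀ i, g i = f i)
    (hb : b = a) : HasSum g b := by
  rw [hb, funext hf]; exact h

lemma hasSum_shift {G : Type*} [AddGroup G] {f : G → ℝ} {a : ℝ} (h : HasSum f a) (c : G) :
    HasSum (fun d => f (d + c)) a :=
  (Equiv.addRight c).hasSum_iff (f := f).2 h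

lemma hasSum_pow_natAbs {x : ℝ} (hx : 0 ≤ x) (hx1 : x < 1) :
    HasSum (fun d : ℤ => x ^ d.natAbs) ((1 + x) / (1 - x)) := by
  have h := hasSum_geometric_of_lt_one hx hx1
  have := HasSum.of_nat_of_neg_add_one (f := fun d : ℤ => x ^ d.natAbs)
    (m := (1 - x)⁻¹) (m' := (1 - x)⁻¹ * x) (by simpa using h) ?_
  · convert this using 1
    ring
  · refine hasSum_of_eq (h.mul_right x) (fun n => ?_) rfl
    rw [← pow_succ]; congr 1

lemma hasSum_one_sub_survival (q θ : ℝ) (n : ℕ) :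
    HasSum (fun d => 1 - (killedStep q θ ^ n) 1 d)
      (θ * ∑ j ∈ Finset.range n, (killedStep q θ ^ j) 1 0) := by
  induction n with
  | zero => simp
  | succ n ih =>
    rw [Finset.sum_range_succ]
    simp_rw [linearMap_pow_succ_apply]
    generalize (killedStep q θ ^ n) 1 = u at ih ⊢
    have h1 := hasSum_shift ih 1
    have h2 := hasSum_shift ih (-1)
    have h3 := hasSum_ite_eq (0 : ℤ) (θ * u 0)
    refine hasSum_of_eq ((((h1.add h2).mul_left q).add (ih.mul_left (1 - 2 * q))).add h3)
      (fun d => ?_) (by ring)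
    rw [killedStep_apply, sub_eq_add_neg d]
    split_ifs with hd
    · subst hd; ring
    · ring

theorem survival_zero_le {q θ : ℝ} (hq : 0 ≤ q) (hθ : 0 < θ) (h : 2 * q + θ ≤ 1) (n : ℕ) :
    (killedStep q θ ^ n) 1 0 ≤ 4 * Real.exp 1 / θ / √(n + 1) := by
  set R : ℝ := √(n + 1) with hR
  have hn : (0 : ℝ) ≤ n := n.cast_nonneg
  have hR2 : R ^ 2 = n + 1 := Real.sq_sqrt (by positivity)
  have hR1 : 1 ≤ R := Real.one_le_sqrt.2 (by linarith)
  set ε : ℝ := 1 / (2 * R) with hε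
  have hε0 : 0 < ε := by positivity
  have hε2 : ε ≤ 1 / 2 := by
    rw [hε]; gcongr; linarith
  have hεR : ε * R = 1 / 2 := by rw [hε]; field_simp
  have hsum := hasSum_one_sub_survival q θ (n + 1)
  have hle := hasSum_le
    (fun d => one_sub_survival_le hq hθ.le h (x := 1 - ε) (by linarith) (n + 1) d)
    hsum ((hasSum_pow_natAbs (x := 1 - ε) (by linarith) (by linarith)).mul_left _)
  have h1 : 1 - ε + (1 - ε)⁻¹ - 2 = ε ^ 2 / (1 - ε) := by
    have : 1 - ε ≠ 0 := by linarith
    field_simp; ring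
  have hB : 1 + q * (1 - ε + (1 - ε)⁻¹ - 2) ≤ Real.exp (4 * q * ε ^ 2) := by
    have h2 : ε ^ 2 / (1 - ε) ≤ 4 * ε ^ 2 := by
      rw [div_le_iff₀ (by linarith)]; nlinarith [sq_nonneg ε]
    have h3 := Real.add_one_le_exp (4 * q * ε ^ 2)
    have h4 := mul_le_mul_of_nonneg_left h2 hq
    rw [h1]; linarith
  have hB0 : 0 ≤ 1 + q * (1 - ε + (1 - ε)⁻¹ - 2) := by
    have : 0 ≤ ε ^ 2 / (1 - ε) := div_nonneg (by positivity) (by linarith)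
    rw [h1]; positivity
  have hBn : (1 + q * (1 - ε + (1 - ε)⁻¹ - 2)) ^ (n + 1) ≤ Real.exp 1 := by
    refine (pow_le_pow_left₀ hB0 hB _).trans ?_
    rw [← Real.exp_nat_mul, Real.exp_le_exp]
    push_cast
    rw [← hR2]
    have : R ^ 2 * (4 * q * ε ^ 2) = 4 * q * (ε * R) ^ 2 := by ring
    rw [this, hεR]; linarith
  have hgeom : (1 + (1 - ε)) / (1 - (1 - ε)) ≤ 4 * R := by
    rw [div_le_iff₀ (by linarith)]; linarith
  have hup : θ * ∑ j ∈ Finset.range (n + 1), (killedStep q θ ^ j) 1 0 ≤ Real.exp 1 * (4 * R) :=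
    hle.trans (mul_le_mul hBn hgeom (div_nonneg (by linarith) (by linarith)) (Real.exp_pos 1).le)
  have hlow : (n + 1) * (killedStep q θ ^ n) 1 0 ≤
      ∑ j ∈ Finset.range (n + 1), (killedStep q θ ^ j) 1 0 := by
    have := Finset.card_nsmul_le_sum (Finset.range (n + 1))
      (fun j => (killedStep q θ ^ j) 1 0) ((killedStep q θ ^ n) 1 0)
      fun j hj => survival_antitone hq hθ.le h (Finset.mem_range_succ_iff.1 hj) 0
    simpa using this
  have := mul_le_mul_of_nonneg_left hlow hθ.le
  rw [← hR2] at this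
  rw [le_div_iff₀ (by positivity), le_div_iff₀ hθ]
  have key : R * ((killedStep q θ ^ n) 1 0 * R * θ) ≤ R * (4 * Real.exp 1) := by linarith
  exact le_of_mul_le_mul_left key (by positivity)

lemma heatKernel_unimodal {r : ℝ} (hr : 0 ≤ r) (h : 3 * r ≤ 1) (n : ℕ) :
    (∀ d, (killedStep r 0 ^ n) (Pi.single 0 1) (-d) = (killedStep r 0 ^ n) (Pi.single 0 1) d) ∧
    ∀ d, 0 ≤ d →
      (killedStep r 0 ^ n) (Pi.single 0 1) (d + 1) ≤ (killedStep r 0 ^ n) (Pi.single 0 1) d := by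
  induction n with
  | zero =>
    refine ⟨fun d => by simp [Pi.single_apply], fun d hd => ?_⟩
    simp only [pow_zero, Module.End.one_apply, Pi.single_apply, show d + 1 ≠ 0 by omega, if_false]
    split_ifs <;> norm_num
  | succ n ih =>
    simp_rw [linearMap_pow_succ_apply, killedStep_apply]
    generalize (killedStep r 0 ^ n) (Pi.single 0 1) = u at ih ⊢
    obtain ⟨hs, hu⟩ := ih
    refine ⟨fun d => ?_, fun d hd => ?_⟩
    · rw [hs, ← hs (-d + 1), ← hs (-d - 1), neg_add, neg_sub', neg_neg]
      simp only [ite_self, sub_neg_eq_add, ← sub_eq_add_neg]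
      ring
    · simp only [ite_self, add_sub_cancel_right]
      have h0 := hu d hd
      have h1 := hu (d + 1) (by omega)
      rcases hd.eq_or_lt with rfl | hd
      · have h2 : u (0 - 1) = u (0 + 1) := by rw [← hs]; norm_num
        rw [h2]
        nlinarith [mul_nonneg hr (sub_nonneg.2 h1), mul_nonneg (sub_nonneg.2 h) (sub_nonneg.2 h0)]
      · have h2 := hu (d - 1) (by omega)
        rw [sub_add_cancel] at h2
        nlinarith [mul_nonneg hr (sub_nonneg.2 h1), mul_nonneg hr (sub_nonneg.2 h2),
          mul_nonneg (show 0 ≤ 1 - 2 * r by linarith) (sub_nonneg.2 h0)]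

lemma heatKernel_le_zero {r : ℝ} (hr : 0 ≤ r) (h : 3 * r ≤ 1) (n : ℕ) (d : ℤ) :
    (killedStep r 0 ^ n) (Pi.single 0 1) d ≤ (killedStep r 0 ^ n) (Pi.single 0 1) 0 := by
  obtain ⟨hs, hu⟩ := heatKernel_unimodal hr h n
  have key : ∀ m : ℕ, (killedStep r 0 ^ n) (Pi.single 0 1) (m : ℤ) ≤
      (killedStep r 0 ^ n) (Pi.single 0 1) 0 := by
    intro m
    induction m with
    | zero => simp
    | succ m ih => push_cast; exact (hu m (by positivity)).trans ih
  rcases Int.natAbs_eq d with hd | hd <;> rw [hd]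
  · exact key _
  · rw [hs]; exact key _

lemma heatKernel_zero_antitone {r : ℝ} (hr : 0 ≤ r) (h : 3 * r ≤ 1) :
    Antitone fun n : ℕ => (killedStep r 0 ^ n) (Pi.single 0 1) 0 := by
  refine antitone_nat_of_succ_le fun n => ?_
  rw [linearMap_pow_succ_apply, killedStep_apply]
  have h1 := heatKernel_le_zero hr h n (0 + 1)
  have h2 := heatKernel_le_zero hr h n (0 - 1)
  simp only [ite_self]
  nlinarith [mul_nonneg hr (sub_nonneg.2 h1), mul_nonneg hr (sub_nonneg.2 h2)]

lemma pow_killedStep_sq (r : ℝ) (n : ℕ) :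
    (killedStep r 0 ^ n) (fun d : ℤ => (d : ℝ) ^ 2) = fun d : ℤ => (d : ℝ) ^ 2 + 2 * r * n := by
  induction n with
  | zero => simp
  | succ n ih =>
    rw [linearMap_pow_succ_apply, ih]
    ext d
    simp only [killedStep_apply, ite_self]
    push_cast; ring

lemma killedStep_abs (r : ℝ) :
    killedStep r 0 (fun d : ℤ => |(d : ℝ)|) =
      (fun d : ℤ => |(d : ℝ)|) + (2 * r) • Pi.single (0 : ℤ) (1 : ℝ) := by
  ext d
  simp only [killedStep_apply, ite_self, Pi.add_apply, Pi.smul_apply, Pi.single_apply, smul_eq_mul]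
  push_cast
  rcases lt_trichotomy d 0 with hd | rfl | hd
  · have h1 : (d : ℝ) ≤ -1 := by exact_mod_cast (by omega : d ≤ -1)
    rw [abs_of_nonpos (by linarith), abs_of_nonpos (by linarith), abs_of_nonpos (by linarith),
      if_neg hd.ne]
    ring
  · simp; ring
  · have h1 : (1 : ℝ) ≤ d := by exact_mod_cast (by omega : 1 ≤ d)
    rw [abs_of_nonneg (by linarith), abs_of_nonneg (by linarith), abs_of_nonneg (by linarith),
      if_neg hd.ne']
    ring

lemma pow_killedStep_abs (r : ℝ) (n : ℕ) :
    (killedStep r 0 ^ n) (fun d : ℤ => |(d : ℝ)|) 0 =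
      2 * r * ∑ j ∈ Finset.range n, (killedStep r 0 ^ j) (Pi.single 0 1) 0 := by
  induction n with
  | zero => simp
  | succ n ih =>
    rw [pow_succ, Module.End.mul_apply, killedStep_abs, map_add, map_smul, Pi.add_apply, ih,
      Finset.sum_range_succ, Pi.smul_apply, smul_eq_mul]
    ring

theorem heatKernel_le {r : ℝ} (hr : 0 < r) (h : 3 * r ≤ 1) (n : ℕ) (d : ℤ) :
    (killedStep r 0 ^ n) (Pi.single 0 1) d ≤ 1 / r / √(n + 1) := by
  refine (heatKernel_le_zero hr.le h n d).trans ?_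
  set R : ℝ := √(n + 1) with hR
  have hR2 : R ^ 2 = n + 1 := Real.sq_sqrt (by positivity)
  have hR0 : 0 < R := Real.sqrt_pos.2 (by positivity)
  have hmono := linearMap_pow_monotone (killedStep_monotone hr.le le_rfl (by linarith)) (n + 1)
    (show (fun d : ℤ => |(d : ℝ)|) ≤
      (1 / (2 * R)) • (fun d : ℤ => (d : ℝ) ^ 2) + (R / 2) • (1 : ℤ → ℝ) from fun d => by
        simp only [Pi.add_apply, Pi.smul_apply, smul_eq_mul, Pi.one_apply, mul_one]
        rw [← sq_abs]
        have : 1 / (2 * R) * |(d : ℝ)| ^ 2 + R / 2 - |(d : ℝ)| = (|(d : ℝ)| - R) ^ 2 / (2 * R) := by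
          field_simp; ring
        have : 0 ≤ (|(d : ℝ)| - R) ^ 2 / (2 * R) := by positivity
        linarith) 0
  have hone : ∀ m : ℕ, (killedStep r 0 ^ m) 1 = 1 := by
    intro m
    induction m with
    | zero => simp
    | succ m ih => rw [linearMap_pow_succ_apply, ih]; ext d; simp [killedStep_one]
  rw [pow_killedStep_abs, map_add, map_smul, map_smul, hone, pow_killedStep_sq] at hmono
  simp only [Pi.add_apply, Pi.smul_apply, smul_eq_mul, Pi.one_apply, mul_one] at hmono
  push_cast at hmono
  rw [← hR2] at hmono
  have hlow : (n + 1) * (killedStep r 0 ^ n) (Pi.single 0 1) 0 ≤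
      ∑ j ∈ Finset.range (n + 1), (killedStep r 0 ^ j) (Pi.single 0 1) 0 := by
    have := Finset.card_nsmul_le_sum (Finset.range (n + 1))
      (fun j => (killedStep r 0 ^ j) (Pi.single 0 1) 0) ((killedStep r 0 ^ n) (Pi.single 0 1) 0)
      fun j hj => heatKernel_zero_antitone hr.le h (Finset.mem_range_succ_iff.1 hj)
    simpa using this
  rw [← hR2] at hlow
  have h1 : 1 / (2 * R) * (0 ^ 2 + 2 * r * R ^ 2) + R / 2 = R * (r + 1 / 2) := by
    field_simp; ring
  rw [h1] at hmono
  have h2 := mul_le_mul_of_nonneg_left hlow (show 0 ≤ 2 * r by positivity)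
  rw [le_div_iff₀ hR0, le_div_iff₀ hr]
  have key : 2 * R * ((killedStep r 0 ^ n) (Pi.single 0 1) 0 * R * r) ≤ 2 * R * 1 := by
    have : R * (r + 1 / 2) ≤ 2 * R * 1 := by nlinarith
    linarith
  exact le_of_mul_le_mul_left key (by positivity)

lemma pairStep_pow_comp_sub (k r θ : ℝ) (n : ℕ) (x y : ℤ) :
    (pairStep k r θ ^ n) 1 (x, y) = (killedStep (k + r) θ ^ n) 1 (y - x) := by
  induction n generalizing x y with
  | zero => simp
  | succ n ih =>
    rw [linearMap_pow_succ_apply, linearMap_pow_succ_apply, pairStep_apply, killedStep_apply]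
    simp only [ih]
    rw [show y - (x + 1) = y - x - 1 by ring, show y - (x - 1) = y - x + 1 by ring,
      show y + 1 - x = y - x + 1 by ring, show y - 1 - x = y - x - 1 by ring]
    simp only [sub_eq_zero, eq_comm (a := x)]
    ring

lemma hasSum_diagonal_pairStep_pow (k r θ : ℝ) (x : ℤ) (n : ℕ) (d : ℤ) :
    HasSum (fun z : ℤ => (pairStep k r θ ^ n) (fun p => if p.1 = x then 1 else 0) (z, z + d))
      ((killedStep (k + r) θ ^ n) 1 d) := by
  induction n generalizing d with
  | zero => simpa using hasSum_ite_eq x (1 : ℝ)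
  | succ n ih =>
    simp_rw [linearMap_pow_succ_apply, pairStep_apply, killedStep_apply]
    generalize (pairStep k r θ ^ n) (fun p => if p.1 = x then 1 else 0) = f at ih ⊢
    generalize (killedStep (k + r) θ ^ n) 1 = s at ih ⊢
    have h1 := hasSum_shift (ih (d - 1)) 1
    have h2 := hasSum_shift (ih (d + 1)) (-1)
    refine hasSum_of_eq ((((h1.add h2).mul_left k).add (((ih (d + 1)).add (ih (d - 1))).mul_left r)).add
      ((ih d).mul_left (1 - 2 * k - 2 * r - if d = 0 then θ else 0))) (fun z => ?_) (by ring)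
    rw [show z + 1 + (d - 1) = z + d by ring, show z + -1 + (d + 1) = z + d by ring,
      show z + (d + 1) = z + d + 1 by ring, show z + (d - 1) = z + d - 1 by ring,
      ← sub_eq_add_neg]
    simp

lemma pairStep_pow_nonneg {k r θ : ℝ} (hk : 0 ≤ k) (hr : 0 ≤ r) (hθ : 0 ≤ θ)
    (h : 2 * k + 2 * r + θ ≤ 1) (n : ℕ) {f : ℤ × ℤ → ℝ} (hf : 0 ≤ f) :
    0 ≤ (pairStep k r θ ^ n) f := by
  simpa using linearMap_pow_monotone (pairStep_monotone hk hr hθ h) n hf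

lemma pairStep_pow_le_heatKernel {k r θ : ℝ} (hk : 0 ≤ k) (hr : 0 ≤ r) (hθ : 0 ≤ θ)
    (h : 2 * k + 2 * r + θ ≤ 1) (n : ℕ) (x y : ℤ) :
    (pairStep k r θ ^ n) (fun p => if p.2 = 0 then 1 else 0) (x, y) ≤
      (killedStep r 0 ^ n) (Pi.single 0 1) y := by
  induction n generalizing x y with
  | zero => simp [Pi.single_apply]
  | succ n ih =>
    have hp := pairStep_pow_nonneg hk hr hθ h n
      (show (0 : ℤ × ℤ → ℝ) ≤ fun p => if p.2 = 0 then 1 else 0 from fun p => by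
        dsimp; split_ifs <;> norm_num) (x, y)
    rw [linearMap_pow_succ_apply, linearMap_pow_succ_apply, pairStep_apply, killedStep_apply]
    have h1 := mul_le_mul_of_nonneg_left (add_le_add (ih (x + 1) y) (ih (x - 1) y)) hk
    have h2 := mul_le_mul_of_nonneg_left (add_le_add (ih x (y + 1)) (ih x (y - 1))) hr
    have h3 := mul_le_mul_of_nonneg_left (ih x y) (show 0 ≤ 1 - 2 * k - 2 * r by linarith)
    have h4 : 0 ≤ (if x = y then θ else 0) *
        (pairStep k r θ ^ n) (fun p => if p.2 = 0 then 1 else 0) (x, y) :=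
      mul_nonneg (by split_ifs <;> simp [hθ]) hp
    simp only [ite_self]
    linarith

/-- The mass on the diagonal decays like `1 / n`: one factor `n ^ (-1/2)` is the probability of
surviving the first half of the time, the other one the heat kernel of the second half. -/
lemma exists_diagonal_le {k r θ : ℝ} (hk : 0 ≤ k) (hr : 0 < r) (hθ : 0 < θ)
    (h : 2 * k + 2 * r + θ ≤ 1) (hr3 : 3 * r ≤ 1) : ∃ C, 0 ≤ C ∧ ∀ (n : ℕ) (z : ℤ),
    (pairStep k r θ ^ n) (fun p => if p.2 = 0 then 1 else 0) (z, z) ≤ C / (n + 1) := by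
  set g : ℤ × ℤ → ℝ := fun p => if p.2 = 0 then 1 else 0
  refine ⟨1 / r * (4 * Real.exp 1 / θ) * 2, by positivity, fun n z => ?_⟩
  set a := n / 2
  set b := n - n / 2
  have hab : n = a + b := by omega
  have hba : (pairStep k r θ ^ b) g ≤ (1 / r / √(b + 1)) • 1 := fun p => by
    simpa using (pairStep_pow_le_heatKernel hk hr.le hθ.le h b p.1 p.2).trans
      (heatKernel_le hr hr3 b p.2)
  have h1 := linearMap_pow_monotone (pairStep_monotone hk hr.le hθ.le h) a hba (z, z)
  rw [map_smul, Pi.smul_apply, pairStep_pow_comp_sub, sub_self, ← Module.End.mul_apply, ← pow_add,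
    ← hab, smul_eq_mul] at h1
  have h2 := survival_zero_le (q := k + r) (by positivity) hθ (by linarith) a
  have ha2 : ((n : ℝ) + 1) / 2 ≤ a + 1 := by
    have : n + 1 ≤ 2 * (a + 1) := by omega
    have : (n : ℝ) + 1 ≤ 2 * (a + 1) := by exact_mod_cast this
    linarith
  have hb2 : ((n : ℝ) + 1) / 2 ≤ b + 1 := by
    have : n + 1 ≤ 2 * (b + 1) := by omega
    have : (n : ℝ) + 1 ≤ 2 * (b + 1) := by exact_mod_cast this
    linarith
  calc _ ≤ _ := h1
    _ ≤ 1 / r / √(((n : ℝ) + 1) / 2) * (4 * Real.exp 1 / θ / √(((n : ℝ) + 1) / 2)) := by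
      gcongr
      · exact survival_nonneg (by positivity) hθ.le (by linarith) a 0
      · refine h2.trans ?_
        gcongr
    _ = 1 / r * (4 * Real.exp 1 / θ) / (√(((n : ℝ) + 1) / 2) * √(((n : ℝ) + 1) / 2)) := by
      field_simp
    _ = _ := by
      rw [Real.mul_self_sqrt (by positivity)]
      field_simp

lemma fst_support_pairStep_pow {f : ℤ × ℤ → ℝ} (k r θ : ℝ)
    (hf : ∃ N : ℕ, ∀ p : ℤ × ℤ, N < p.1.natAbs → f p = 0) (n : ℕ) :
    ∃ N : ℕ, ∀ p : ℤ × ℤ, N < p.1.natAbs → (pairStep k r θ ^ n) f p = 0 := by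
  induction n with
  | zero => simpa using hf
  | succ n ih =>
    obtain ⟨N, hN⟩ := ih
    refine ⟨N + 1, fun ⟨x, y⟩ hp => ?_⟩
    dsimp at hp
    rw [linearMap_pow_succ_apply, pairStep_apply]
    repeat rw [hN _ (by dsimp; omega)]
    ring

lemma snd_support_pairStep_pow {f : ℤ × ℤ → ℝ} (k r θ : ℝ)
    (hf : ∃ N : ℕ, ∀ p : ℤ × ℤ, N < p.2.natAbs → f p = 0) (n : ℕ) :
    ∃ N : ℕ, ∀ p : ℤ × ℤ, N < p.2.natAbs → (pairStep k r θ ^ n) f p = 0 := by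
  induction n with
  | zero => simpa using hf
  | succ n ih =>
    obtain ⟨N, hN⟩ := ih
    refine ⟨N + 1, fun ⟨x, y⟩ hp => ?_⟩
    dsimp at hp
    rw [linearMap_pow_succ_apply, pairStep_apply]
    repeat rw [hN _ (by dsimp; omega)]
    ring

lemma summable_shift_mul {h f : ℤ × ℤ → ℝ}
    (hh : ∃ N : ℕ, ∀ p : ℤ × ℤ, N < p.1.natAbs → h p = 0)
    (hf : ∃ N : ℕ, ∀ p : ℤ × ℤ, N < p.2.natAbs → f p = 0) (c : ℤ × ℤ) :
    Summable fun p => h (p + c) * f p := by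
  obtain ⟨N, hN⟩ := hh
  obtain ⟨M, hM⟩ := hf
  refine summable_of_ne_finset_zero (s := Finset.Icc (-(N + c.1.natAbs : ℤ)) (N + c.1.natAbs) ×ˢ
    Finset.Icc (-(M : ℤ)) M) fun p hp => ?_
  by_cases h1 : M < p.2.natAbs
  · rw [hM p h1, mul_zero]
  · rw [hN (p + c), zero_mul]
    simp only [Finset.mem_product, Finset.mem_Icc] at hp
    rw [Prod.fst_add]
    omega

lemma tsum_mul_pairStep_sub {h f : ℤ × ℤ → ℝ} (k r θ₁ θ₂ : ℝ)
    (hh : ∃ N : ℕ, ∀ p : ℤ × ℤ, N < p.1.natAbs → h p = 0)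
    (hf : ∃ N : ℕ, ∀ p : ℤ × ℤ, N < p.2.natAbs → f p = 0) :
    ∑' p, h p * pairStep k r θ₁ f p - ∑' p, pairStep k r θ₂ h p * f p =
      (θ₂ - θ₁) * ∑' z : ℤ, h (z, z) * f (z, z) := by
  have hS : ∀ c, HasSum (fun p => h (p + c) * f p) (∑' p, h (p + c) * f p) :=
    fun c => (summable_shift_mul hh hf c).hasSum
  have hS' : ∀ c, HasSum (fun p => h p * f (p + c)) (∑' p, h (p + -c) * f p) :=
    fun c => hasSum_of_eq (hasSum_shift (hS (-c)) c) (fun p => by rw [add_neg_cancel_right]) rfl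
  have hdiag : HasSum (fun p : ℤ × ℤ => if p.1 = p.2 then h p * f p else 0)
      (∑' z : ℤ, h (z, z) * f (z, z)) := by
    have hinj : Function.Injective fun z : ℤ => (z, z) := fun a b hab => congrArg Prod.fst hab
    rw [← hinj.hasSum_iff]
    · have h0 : Summable fun p => h p * f p := by simpa using summable_shift_mul hh hf 0
      simpa [Function.comp_def] using (h0.comp_injective hinj).hasSum
    · rintro ⟨x, y⟩ hp
      refine if_neg fun hxy => hp ⟨x, ?_⟩
      dsimp at hxy
      rw [hxy]
  have e1 : ∀ p : ℤ × ℤ, p + (1, 0) = (p.1 + 1, p.2) := fun p => by ext <;> simp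
  have e2 : ∀ p : ℤ × ℤ, p + (-1, 0) = (p.1 - 1, p.2) := fun p => by ext <;> simp [sub_eq_add_neg]
  have e3 : ∀ p : ℤ × ℤ, p + (0, 1) = (p.1, p.2 + 1) := fun p => by ext <;> simp
  have e4 : ∀ p : ℤ × ℤ, p + (0, -1) = (p.1, p.2 - 1) := fun p => by ext <;> simp [sub_eq_add_neg]
  have H1 := ((((hS' (1, 0)).add (hS' (-1, 0))).mul_left k).add
    (((hS' (0, 1)).add (hS' (0, -1))).mul_left r)).add
    (((hS' 0).mul_left (1 - 2 * k - 2 * r)).sub (hdiag.mul_left θ₁))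
  have H2 := ((((hS (1, 0)).add (hS (-1, 0))).mul_left k).add
    (((hS (0, 1)).add (hS (0, -1))).mul_left r)).add
    (((hS 0).mul_left (1 - 2 * k - 2 * r)).sub (hdiag.mul_left θ₂))
  have H1' := (hasSum_of_eq (g := fun p => h p * pairStep k r θ₁ f p) H1 (fun p => by
    rw [e1, e2, e3, e4, add_zero, pairStep_apply k r θ₁ f p.1 p.2]
    split_ifs <;> ring) rfl).tsum_eq
  have H2' := (hasSum_of_eq (g := fun p => pairStep k r θ₂ h p * f p) H2 (fun p => by
    rw [e1, e2, e3, e4, add_zero, pairStep_apply k r θ₂ h p.1 p.2]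
    split_ifs <;> ring) rfl).tsum_eq
  rw [H1', H2']
  simp only [Prod.neg_mk, neg_zero, neg_neg]
  ring

lemma tsum_mul_pairStep_pow_sub {h f : ℤ × ℤ → ℝ} (k r θ₁ θ₂ : ℝ)
    (hh : ∃ N : ℕ, ∀ p : ℤ × ℤ, N < p.1.natAbs → h p = 0)
    (hf : ∃ N : ℕ, ∀ p : ℤ × ℤ, N < p.2.natAbs → f p = 0) (n : ℕ) :
    ∑' p, h p * (pairStep k r θ₁ ^ n) f p - ∑' p, (pairStep k r θ₂ ^ n) h p * f p =
      (θ₂ - θ₁) * ∑ j ∈ Finset.range n, ∑' z : ℤ,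
        (pairStep k r θ₂ ^ (n - 1 - j)) h (z, z) * (pairStep k r θ₁ ^ j) f (z, z) := by
  have key := Finset.sum_range_sub
    (fun j => ∑' p, (pairStep k r θ₂ ^ (n - j)) h p * (pairStep k r θ₁ ^ j) f p) n
  simp only [Nat.sub_self, Nat.sub_zero, pow_zero, Module.End.one_apply] at key
  rw [← key, Finset.mul_sum]
  refine Finset.sum_congr rfl fun j hj => ?_
  have hj := Finset.mem_range.1 hj
  rw [show n - (j + 1) = n - 1 - j by omega, show n - j = n - 1 - j + 1 by omega,
    linearMap_pow_succ_apply, linearMap_pow_succ_apply]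
  exact tsum_mul_pairStep_sub k r θ₁ θ₂ (fst_support_pairStep_pow k r θ₂ hh _)
    (snd_support_pairStep_pow k r θ₁ hf j)

lemma tendsto_convolution (C D : ℝ) : Tendsto (fun n : ℕ => ∑ j ∈ Finset.range n,
    (C / √((n - 1 - j : ℕ) + 1)) * (D / (j + 1))) atTop (𝓝 0) := by
  suffices h : Tendsto (fun n : ℕ => ∑ j ∈ Finset.range n,
      (1 / √((n - 1 - j : ℕ) + 1)) * (1 / (j + 1 : ℝ))) atTop (𝓝 0) by
    have := h.const_mul (C * D)
    rw [mul_zero] at this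
    refine this.congr fun n => ?_
    rw [Finset.mul_sum]
    refine Finset.sum_congr rfl fun j _ => ?_
    ring
  have hlim : Tendsto (fun n : ℕ => (3 + Real.log n) / √n) atTop (𝓝 0) := by
    have h1 : Tendsto (fun x : ℝ => (3 + Real.log x) / √x) atTop (𝓝 0) := by
      have h2 : (fun x : ℝ => Real.log x) =o[atTop] fun x => x ^ (1 / 2 : ℝ) :=
        isLittleO_log_rpow_atTop (by norm_num)
      have h3 : (fun x : ℝ => (3 : ℝ)) =o[atTop] fun x => x ^ (1 / 2 : ℝ) :=
        Asymptotics.isLittleO_const_left.2 (Or.inr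
          (tendsto_norm_atTop_atTop.comp (tendsto_rpow_atTop (by norm_num))))
      simpa [Real.sqrt_eq_rpow] using (h3.add h2).tendsto_div_nhds_zero
    exact h1.comp tendsto_natCast_atTop_atTop
  refine squeeze_zero' (Eventually.of_forall fun n => Finset.sum_nonneg fun j _ => by positivity)
    ?_ hlim
  filter_upwards [eventually_gt_atTop 0] with n hn
  have hn' : (0 : ℝ) < n := by exact_mod_cast hn
  have hterm : ∀ j ∈ Finset.range n, (1 / √((n - 1 - j : ℕ) + 1)) * (1 / (j + 1 : ℝ)) ≤
      1 / n * (1 / √((n - 1 - j : ℕ) + 1) + √n * (1 / (j + 1))) := by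
    intro j hj
    have hj := Finset.mem_range.1 hj
    set A : ℝ := (n - 1 - j : ℕ) + 1 with hA
    have hA0 : 0 < A := by positivity
    have hAn : A + (j + 1) = n + 1 := by
      rw [hA]; have : (n - 1 - j) + 1 + (j + 1) = n + 1 := by omega
      exact_mod_cast this
    have hj0 : (0 : ℝ) ≤ j := j.cast_nonneg
    have hs : √A ≤ √n := Real.sqrt_le_sqrt (by linarith)
    have hs0 : 0 < √A := Real.sqrt_pos.2 hA0
    have hsq : √A * √A = A := Real.mul_self_sqrt hA0.le
    have : 1 / √A * (1 / (j + 1 : ℝ)) = 1 / (n + 1) * (1 / √A + √A * (1 / (j + 1))) := by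
      rw [← hAn]; field_simp; rw [pow_two, hsq]; ring
    rw [this]
    gcongr
    linarith
  refine (Finset.sum_le_sum hterm).trans ?_
  rw [← Finset.mul_sum, Finset.sum_add_distrib, ← Finset.mul_sum]
  have hsqrt : ∀ m : ℕ, ∑ j ∈ Finset.range m, 1 / √((j : ℝ) + 1) ≤ 2 * √m := by
    intro m
    induction m with
    | zero => simp
    | succ m ih =>
      rw [Finset.sum_range_succ]
      have h1 : √(m : ℝ) ≤ √((m : ℝ) + 1) := Real.sqrt_le_sqrt (by linarith)
      have h2 : √(m : ℝ) * √(m : ℝ) = m := Real.mul_self_sqrt (by positivity)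
      have h3 : √((m : ℝ) + 1) * √((m : ℝ) + 1) = m + 1 := Real.mul_self_sqrt (by positivity)
      have h4 : 0 < √((m : ℝ) + 1) := Real.sqrt_pos.2 (by positivity)
      have h5 : 1 / √((m : ℝ) + 1) ≤ 2 * (√((m : ℝ) + 1) - √m) := by
        rw [div_le_iff₀ h4]; nlinarith [sq_nonneg (√((m : ℝ) + 1) - √m)]
      push_cast
      linarith
  have hrefl : ∑ j ∈ Finset.range n, 1 / √(((n - 1 - j : ℕ) : ℝ) + 1) ≤ 2 * √n := by
    rw [Finset.sum_range_reflect (fun j : ℕ => 1 / √((j : ℝ) + 1))]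
    exact hsqrt n
  have hharm : ∑ j ∈ Finset.range n, 1 / ((j : ℝ) + 1) ≤ 1 + Real.log n := by
    have := harmonic_le_one_add_log n
    rw [harmonic] at this
    push_cast at this
    simpa using this
  have hs0 : 0 < √(n : ℝ) := Real.sqrt_pos.2 hn'
  have hsq : √(n : ℝ) * √n = n := Real.mul_self_sqrt hn'.le
  calc _ ≤ 1 / (n : ℝ) * (2 * √n + √n * (1 + Real.log n)) := by gcongr
    _ = (3 + Real.log n) * √n / (√n * √n) := by rw [hsq]; ring
    _ = _ := by field_simp

/-- The discrete-time analogue of the main theorem. -/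
theorem tendsto_tsum_pairStep_pow_sub {k r θ₁ θ₂ : ℝ} (hk : 0 ≤ k) (hr : 0 < r) (hθ₁ : 0 < θ₁)
    (hθ₂ : 0 < θ₂) (h₁ : 2 * k + 2 * r + θ₁ ≤ 1) (h₂ : 2 * k + 2 * r + θ₂ ≤ 1) (hr3 : 3 * r ≤ 1)
    (x : ℤ) :
    Tendsto (fun n : ℕ => ∑' y : ℤ, (pairStep k r θ₁ ^ n) (fun p => if p.2 = 0 then 1 else 0) (x, y)
      - ∑' y : ℤ, (pairStep k r θ₂ ^ n) (fun p => if p.2 = 0 then 1 else 0) (x, y))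
      atTop (𝓝 0) := by
  obtain ⟨C, hC, hdiag⟩ := exists_diagonal_le hk hr hθ₁ h₁ hr3
  set g : ℤ × ℤ → ℝ := fun p => if p.2 = 0 then 1 else 0 with hg
  set φ : ℤ × ℤ → ℝ := fun p => if p.1 = x then 1 else 0 with hφ
  have hg0 : 0 ≤ g := fun p => by simp only [hg]; split_ifs <;> simp
  have hφ0 : 0 ≤ φ := fun p => by simp only [hφ]; split_ifs <;> simp
  have hgs : ∃ N : ℕ, ∀ p : ℤ × ℤ, N < p.2.natAbs → g p = 0 :=
    ⟨0, fun p hp => if_neg (by omega)⟩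
  have hφs : ∃ N : ℕ, ∀ p : ℤ × ℤ, N < p.1.natAbs → φ p = 0 :=
    ⟨x.natAbs, fun p hp => if_neg (by rintro rfl; omega)⟩
  have hrow : ∀ f : ℤ × ℤ → ℝ, ∑' y : ℤ, f (x, y) = ∑' p, φ p * f p := by
    intro f
    have hinj : Function.Injective fun y : ℤ => (x, y) := Prod.mk_right_injective x
    rw [← hinj.tsum_eq (f := fun p => φ p * f p)]
    · simp [hφ]
    · rintro ⟨a, b⟩ hp
      refine ⟨b, ?_⟩
      by_contra hab
      exact hp (by simp [hφ, show a ≠ x by rintro rfl; exact hab rfl])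
  refine squeeze_zero_norm (a := fun n : ℕ => |θ₂ - θ₁| * ∑ j ∈ Finset.range n,
    (4 * Real.exp 1 / θ₂ / √((n - 1 - j : ℕ) + 1)) * (C / (j + 1))) (fun n => ?_) ?_
  · rw [hrow, hrow]
    have e1 := tsum_mul_pairStep_pow_sub k r θ₁ θ₂ hφs hgs n
    have e2 := tsum_mul_pairStep_pow_sub k r θ₂ θ₂ hφs hgs n
    rw [sub_self, zero_mul, sub_eq_zero] at e2
    rw [e2, e1, norm_mul, Real.norm_eq_abs]
    gcongr
    refine norm_sum_le_of_le _ fun j _ => ?_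
    have hs := hasSum_diagonal_pairStep_pow k r θ₂ x (n - 1 - j) 0
    simp only [add_zero] at hs
    have hp : ∀ z, 0 ≤ (pairStep k r θ₂ ^ (n - 1 - j)) φ (z, z) :=
      fun z => pairStep_pow_nonneg hk hr.le hθ₂.le h₂ _ hφ0 (z, z)
    have hf : ∀ z, 0 ≤ (pairStep k r θ₁ ^ j) g (z, z) :=
      fun z => pairStep_pow_nonneg hk hr.le hθ₁.le h₁ _ hg0 (z, z)
    have hle := tsum_of_norm_bounded (f := fun z : ℤ =>
      (pairStep k r θ₂ ^ (n - 1 - j)) φ (z, z) * (pairStep k r θ₁ ^ j) g (z, z))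
      (hs.mul_right (C / (j + 1))) fun z => by
        rw [Real.norm_of_nonneg (mul_nonneg (hp z) (hf z))]
        exact mul_le_mul_of_nonneg_left (hdiag j z) (hp z)
    refine hle.trans ?_
    gcongr
    exact survival_zero_le (by positivity) hθ₂ (by linarith) _
  · simpa using (tendsto_convolution (4 * Real.exp 1 / θ₂) C).const_mul |θ₂ - θ₁|

/-- Poisson averages of a null sequence tend to zero as the parameter tends to infinity. -/
lemma tendsto_poisson_average {a : ℕ → ℝ} (ha : Tendsto a atTop (𝓝 0)) {A : ℝ → ℝ}
    (hA : ∀ s, 0 ≤ s → HasSum (fun n : ℕ => s ^ n / n.factorial * a n) (A s)) :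
    Tendsto (fun s => Real.exp (-s) * A s) atTop (𝓝 0) := by
  rw [Metric.tendsto_nhds]
  intro ε hε
  obtain ⟨N, hN⟩ := Metric.tendsto_atTop.1 ha (ε / 2) (by positivity)
  have hfin : Tendsto (fun s : ℝ => ∑ n ∈ Finset.range N, Real.exp (-s) * (s ^ n / n.factorial * |a n|))
      atTop (𝓝 0) := by
    rw [← Finset.sum_const_zero (s := Finset.range N)]
    refine tendsto_finsetSum _ fun n _ => ?_
    have := (Real.tendsto_pow_mul_exp_neg_atTop_nhds_zero n).mul_const (|a n| / n.factorial)
    rw [zero_mul] at this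
    refine this.congr fun s => ?_
    ring
  filter_upwards [hfin.eventually (gt_mem_nhds (show 0 < ε / 2 by positivity)),
    eventually_ge_atTop 0] with s hs hs0
  rw [dist_zero_right]
  have hexp : HasSum (fun n : ℕ => s ^ n / n.factorial) (Real.exp s) := by
    rw [Real.exp_eq_exp_ℝ]; exact NormedSpace.expSeries_div_hasSum_exp s
  have hsum := (hasSum_sum_of_ne_finset_zero (s := Finset.range N)
    (f := fun n => if n < N then s ^ n / n.factorial * |a n| else 0)
    fun n hn => if_neg (by simpa using hn)).add (hexp.mul_right (ε / 2))
  have hle : ‖A s‖ ≤ (∑ n ∈ Finset.range N, if n < N then s ^ n / n.factorial * |a n| else 0) +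
      Real.exp s * (ε / 2) := by
    rw [← (hA s hs0).tsum_eq]
    refine tsum_of_norm_bounded hsum fun n => ?_
    rw [norm_mul, Real.norm_eq_abs, Real.norm_eq_abs, abs_of_nonneg (by positivity)]
    split_ifs with hn
    · have : 0 ≤ s ^ n / n.factorial * (ε / 2) := by positivity
      linarith
    · rw [zero_add]
      gcongr
      simpa using (hN n (by omega)).le
  rw [norm_mul, Real.norm_of_nonneg (Real.exp_pos _).le]
  calc _ ≤ _ := mul_le_mul_of_nonneg_left hle (Real.exp_pos (-s)).le
    _ = ∑ n ∈ Finset.range N, Real.exp (-s) * (s ^ n / n.factorial * |a n|) + ε / 2 := by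
      rw [mul_add, ← mul_assoc, ← Real.exp_add, neg_add_cancel, Real.exp_zero, one_mul,
        Finset.mul_sum]
      congr 1
      exact Finset.sum_congr rfl fun n hn => by rw [if_pos (Finset.mem_range.1 hn)]
    _ < ε := by linarith

lemma eq_exp_smul_apply_of_hasDerivAt {E : Type*} [NormedAddCommGroup E] [NormedSpace ℝ E]
    [CompleteSpace E] {H : E →L[ℝ] E} {w : ℝ → E} (hw : ∀ t, HasDerivAt w (H (w t)) t) (t : ℝ) :
    w t = NormedSpace.exp (t • H) (w 0) := by
  have hd : ∀ s, HasDerivAt (fun s : ℝ => NormedSpace.exp (s • -H) (w s)) 0 s := by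
    intro s
    have h := (hasDerivAt_exp_smul_const (-H) s).clm_apply (hw s)
    refine h.congr_deriv ?_
    simp
  have hc := is_const_of_deriv_eq_zero (fun s => (hd s).differentiableAt) (fun s => (hd s).deriv) t 0
  simp only [zero_smul, NormedSpace.exp_zero, one_apply_eq_self] at hc
  let +nondep : NormedAlgebra ℚ (E →L[ℝ] E) := .restrictScalars ℚ ℝ _
  rw [← hc, ← mul_apply_eq_comp, ← NormedSpace.exp_add_of_commute, smul_neg,
    add_neg_cancel, NormedSpace.exp_zero, one_apply_eq_self]
  exact ((Commute.refl H).neg_right.smul_left t).smul_right t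

/-- Uniformization: the semigroup generated by `L • (Q - 1)` is a Poisson mixture of powers of
`Q`. -/
lemma hasSum_uniformization {E : Type*} [NormedAddCommGroup E] [NormedSpace ℝ E]
    [CompleteSpace E] {Q : E →L[ℝ] E} {L : ℝ} {w : ℝ → E}
    (hw : ∀ t, HasDerivAt w ((L • (Q - 1)) (w t)) t) (t : ℝ) :
    HasSum (fun n : ℕ => ((L * t) ^ n / n.factorial) • (Q ^ n) (w 0)) (Real.exp (L * t) • w t) := by
  have hv : ∀ s, HasDerivAt (fun s => Real.exp (L * s) • w s)
      ((L • Q) (Real.exp (L * s) • w s)) s := by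
    intro s
    have h1 : HasDerivAt (fun s => Real.exp (L * s)) (Real.exp (L * s) * (L * 1)) s :=
      ((hasDerivAt_id s).const_mul L).exp
    refine (h1.smul (hw s)).congr_deriv ?_
    simp only [_root_.smul_apply, _root_.sub_apply,
      one_apply_eq_self, map_smul]
    module
  have h := eq_exp_smul_apply_of_hasDerivAt hv t
  simp only [mul_zero, Real.exp_zero, one_smul] at h
  have hs := (NormedSpace.exp_series_hasSum_exp' (𝕂 := ℝ) (t • L • Q)).mapL
    (ContinuousLinearMap.apply ℝ E (w 0))
  rw [ContinuousLinearMap.apply_apply, ← h] at hs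
  refine hs.congr_fun fun n => ?_
  simp only [ContinuousLinearMap.apply_apply, smul_smul, smul_pow, _root_.smul_apply]
  congr 1
  ring

lemma hasSum_mass {κ ρ γ L : ℝ} (hκ : 0 ≤ κ) (hρ : 0 ≤ ρ) (hγ : γ ≤ 0) (hL : 0 < L)
    (hle : 2 * κ + 2 * ρ - γ ≤ L)
    {H : (ℤ × ℤ →ᵇ ℝ) →L[ℝ] (ℤ × ℤ →ᵇ ℝ)}
    (hH : ∀ (f : ℤ × ℤ →ᵇ ℝ) (q : ℤ × ℤ),
      H f q = κ * ((f (q.1 + 1, q.2) - f q) + (f (q.1 - 1, q.2) - f q))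
        + ρ * ((f (q.1, q.2 + 1) - f q) + (f (q.1, q.2 - 1) - f q))
        + γ * (if q.1 = q.2 then f q else 0))
    {w : ℝ → (ℤ × ℤ →ᵇ ℝ)} (hw : ∀ t : ℝ, HasDerivAt w (H (w t)) t) (hw0 : 0 ≤ ⇑(w 0))
    {x : ℤ} {t m : ℝ} (ht : 0 ≤ t) (hm : HasSum (fun y : ℤ => w t (x, y)) m) :
    HasSum (fun n : ℕ => (L * t) ^ n / n.factorial *
      ∑' y : ℤ, (pairStep (κ / L) (ρ / L) (-γ / L) ^ n) (w 0) (x, y)) (Real.exp (L * t) * m) := by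
  set T := pairStep (κ / L) (ρ / L) (-γ / L)
  set Q : (ℤ × ℤ →ᵇ ℝ) →L[ℝ] (ℤ × ℤ →ᵇ ℝ) := 1 + L⁻¹ • H with hQ
  have hHQ : H = L • (Q - 1) := by
    ext1 v
    simp [hQ, smul_smul, hL.ne']
  have hQT : ∀ f : ℤ × ℤ →ᵇ ℝ, ⇑(Q f) = T f := by
    intro f
    ext ⟨a, b⟩
    simp only [hQ, T, pairStep_apply, _root_.add_apply, one_apply_eq_self,
      _root_.smul_apply, BoundedContinuousFunction.add_apply,
      BoundedContinuousFunction.smul_apply, hH, smul_eq_mul]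
    split_ifs <;> field_simp <;> ring
  have hQTn : ∀ n : ℕ, ⇑((Q ^ n) (w 0)) = (T ^ n) (w 0) := by
    intro n
    induction n with
    | zero => simp
    | succ n ih =>
      rw [pow_succ', mul_apply_eq_comp, hQT, ih, linearMap_pow_succ_apply]
  have hT : ∀ n, 0 ≤ (T ^ n) (w 0) := fun n =>
    pairStep_pow_nonneg (by positivity) (by positivity) (div_nonneg (by linarith) hL.le)
      (by rw [← mul_div_assoc, ← mul_div_assoc, ← add_div, ← add_div, div_le_one hL]; linarith) n hw0
  have hpt : ∀ y, HasSum (fun n : ℕ => (L * t) ^ n / n.factorial * (T ^ n) (w 0) (x, y))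
      (Real.exp (L * t) * w t (x, y)) := by
    intro y
    have h := (hasSum_uniformization (Q := Q) (fun s => hHQ ▸ hw s) t).mapL
      (BoundedContinuousFunction.evalCLM ℝ (x, y))
    refine hasSum_of_eq h (fun n => ?_) ?_
    · rw [← hQTn]; simp
    · simp
  have hs : Summable fun p : ℤ × ℕ => (L * t) ^ p.2 / p.2.factorial * (T ^ p.2) (w 0) (x, p.1) := by
    refine (summable_prod_of_nonneg fun p => ?_).2 ⟨fun y => (hpt y).summable, ?_⟩
    · exact mul_nonneg (by positivity) (hT _ _)
    · simp only [(hpt _).tsum_eq]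
      exact (hm.mul_left _).summable
  have hsum : HasSum (fun p : ℤ × ℕ => (L * t) ^ p.2 / p.2.factorial * (T ^ p.2) (w 0) (x, p.1))
      (Real.exp (L * t) * m) := by
    rw [(hm.mul_left _).unique (hs.hasSum.prod_fiberwise hpt)]
    exact hs.hasSum
  have hswap := (Equiv.prodComm ℕ ℤ).hasSum_iff.2 hsum
  refine hswap.prod_fiberwise fun n => ?_
  rw [← tsum_mul_left]
  exact (hswap.summable.prod_factor n).hasSum

/-- For `d = 1`, the large-time behaviour of the expected mass
`m_x^γ(t) = Σ_y (exp(tĤ_γ)g)(x,y)` (homogeneous initial condition, moving trap of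
strength `−γ`, `Ĥ_γ = Â + γV̂` on `ℓ^∞(ℤ × ℤ)`, `g(x,y)=1_{y=0}`) does not depend
on the strength `γ < 0`: for any `γ₁, γ₂ ∈ (−∞,0)` and every `x ∈ ℤ`,
`lim_{t→∞} (m_x^{γ₁}(t) − m_x^{γ₂}(t)) = 0`.
The semigroups are encoded as the (unique, since the operators are bounded)
solutions of the corresponding linear ODEs; the convergent series defining
`m_x^γ(t)` is encoded by `HasSum`. -/
theorem moving_trap_homogeneous_dim_one_indep_of_gamma
    (κ ρ γ₁ γ₂ : ℝ) (hκ : 0 < κ) (hρ : 0 < ρ) (hγ₁ : γ₁ < 0) (hγ₂ : γ₂ < 0)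
    (H₁ H₂ : (ℤ × ℤ →ᵇ ℝ) →L[ℝ] (ℤ × ℤ →ᵇ ℝ))
    (hH₁ : ∀ (f : ℤ × ℤ →ᵇ ℝ) (q : ℤ × ℤ),
      H₁ f q = κ * ((f (q.1 + 1, q.2) - f q) + (f (q.1 - 1, q.2) - f q))
        + ρ * ((f (q.1, q.2 + 1) - f q) + (f (q.1, q.2 - 1) - f q))
        + γ₁ * (if q.1 = q.2 then f q else 0))
    (hH₂ : ∀ (f : ℤ × ℤ →ᵇ ℝ) (q : ℤ × ℤ),
      H₂ f q = κ * ((f (q.1 + 1, q.2) - f q) + (f (q.1 - 1, q.2) - f q))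
        + ρ * ((f (q.1, q.2 + 1) - f q) + (f (q.1, q.2 - 1) - f q))
        + γ₂ * (if q.1 = q.2 then f q else 0))
    (g : ℤ × ℤ →ᵇ ℝ)
    (hg : ∀ q : ℤ × ℤ, g q = if q.2 = 0 then 1 else 0)
    (w₁ w₂ : ℝ → (ℤ × ℤ →ᵇ ℝ)) (hw₁0 : w₁ 0 = g) (hw₂0 : w₂ 0 = g)
    (hw₁ : ∀ t : ℝ, HasDerivAt w₁ (H₁ (w₁ t)) t)
    (hw₂ : ∀ t : ℝ, HasDerivAt w₂ (H₂ (w₂ t)) t)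
    (m₁ m₂ : ℤ → ℝ → ℝ)
    (hm₁ : ∀ (x : ℤ) (t : ℝ), HasSum (fun y : ℤ => w₁ t (x, y)) (m₁ x t))
    (hm₂ : ∀ (x : ℤ) (t : ℝ), HasSum (fun y : ℤ => w₂ t (x, y)) (m₂ x t))
    (x : ℤ) :
    Tendsto (fun t : ℝ => m₁ x t - m₂ x t) atTop (𝓝 0) := by
  set L : ℝ := 4 * κ + 4 * ρ - γ₁ - γ₂ with hLdef
  have hL : 0 < L := by linarith
  have hg' : ⇑g = fun p : ℤ × ℤ => if p.2 = 0 then (1 : ℝ) else 0 := funext hg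
  have hg0 : 0 ≤ ⇑g := fun p => by rw [hg]; simp only [Pi.zero_apply]; split_ifs <;> norm_num
  have hle : ∀ γ, γ₁ + γ₂ ≤ γ → 2 * (κ / L) + 2 * (ρ / L) + -γ / L ≤ 1 := fun γ hγ => by
    rw [← mul_div_assoc, ← mul_div_assoc, ← add_div, ← add_div, div_le_one hL]; linarith
  have hdisc := tendsto_tsum_pairStep_pow_sub (k := κ / L) (r := ρ / L) (θ₁ := -γ₁ / L)
    (θ₂ := -γ₂ / L) (by positivity) (by positivity) (div_pos (by linarith) hL)
    (div_pos (by linarith) hL) (hle γ₁ (by linarith)) (hle γ₂ (by linarith))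
    (by rw [← mul_div_assoc, div_le_one hL]; linarith) x
  rw [← hg'] at hdisc
  have hA : ∀ s, 0 ≤ s → HasSum _ (Real.exp s * (m₁ x (s / L) - m₂ x (s / L))) := fun s hs => by
    have hs' : 0 ≤ s / L := by positivity
    have h1 := hasSum_mass (L := L) hκ.le hρ.le hγ₁.le hL (by linarith) hH₁ hw₁
      (by rw [hw₁0]; exact hg0) hs' (hm₁ x _)
    have h2 := hasSum_mass (L := L) hκ.le hρ.le hγ₂.le hL (by linarith) hH₂ hw₂
      (by rw [hw₂0]; exact hg0) hs' (hm₂ x _)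
    rw [mul_div_cancel₀ _ hL.ne', hw₁0] at h1
    rw [mul_div_cancel₀ _ hL.ne', hw₂0] at h2
    exact hasSum_of_eq (h1.sub h2) (fun n => mul_sub _ _ _) (mul_sub _ _ _)
  refine ((tendsto_poisson_average hdisc hA).comp (tendsto_id.const_mul_atTop hL)).congr fun t => ?_
  simp only [Function.comp_apply, id_eq]
  rw [← mul_assoc, ← Real.exp_add, neg_add_cancel, Real.exp_zero, one_mul,
    mul_div_cancel_left₀ _ hL.ne']
end
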